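/- Let d ∈ ℕ, n ∈ {0,1,2,3}, c ∈ [1,∞), and let p¹,…,p^d be probability kernels on [0,1] such that for every k ∈ {1,…,d}, every m' ∈ {0,…,n}, and every φ ∈ C^{m'}([0,1],ℝ) the function z ↦ ∫ φ(y) p^k(z,dy) belongs to C^{m'}([0,1],ℝ) and satisfies ‖z ↦ ∫ φ(y) p^k(z,dy)‖_{C^{m'}} ≤ c ‖φ‖_{C^{m'}}. Define (T²f)(x) := ∫ f(y) ⊗_{k=1}^d p^k(x_k,dy_k). Then for every f ∈ C^n([0,1]^d,ℝ), every i ∈ {1,…,d}, and every x ∈ [0,1]^d it holds that |(∂^n/∂x_i^n)(T²f)(x)| ≤ c · max_{k ∈ {0,…,n}} ‖∂^k f/∂x_i^k‖_∞. -/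

import Mathlib

open MeasureTheory Filter

noncomputable section

/-- The unit cube `[0,1]^d` in `ℝ^d`. -/
def cube (d : ℕ) : Set (Fin d → ℝ) := Set.univ.pi fun _ => Set.Icc (0:ℝ) 1

/-- Partial derivative in coordinate `i` (within `[0,1]`, i.e. one-sided at the boundary). -/
def pd (d : ℕ) (i : Fin d) (g : (Fin d → ℝ) → ℝ) : (Fin d → ℝ) → ℝ :=
  fun x => derivWithin (fun t => g (Function.update x i t)) (Set.Icc (0:ℝ) 1) (x i)

/-- Iterated partial derivative `∂^α` (coordinates applied in a fixed order). -/
def mderiv (d : ℕ) (α : Fin d → ℕ) (f : (Fin d → ℝ) → ℝ) : (Fin d → ℝ) → ℝ :=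
  List.foldr (fun i g => (pd d i)^[α i] g) f (List.finRange d)

/-- `f ∈ C^m([0,1]^d, ℝ)`: all partial derivatives of order `0` through `m` exist
(one-sidedly at the boundary) and are continuous on the cube. -/
def MemCm (d : ℕ) : ℕ → ((Fin d → ℝ) → ℝ) → Prop
  | 0, f => ContinuousOn f (cube d)
  | m + 1, f => ContinuousOn f (cube d) ∧ ∀ i : Fin d,
      (∀ x ∈ cube d, DifferentiableWithinAt ℝ (fun t => f (Function.update x i t))
        (Set.Icc (0:ℝ) 1) (x i)) ∧
      MemCm d m (pd d i f)

/-- Sup norm over the cube: `‖g‖_∞ = sup_{x ∈ [0,1]^d} |g(x)|`. -/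
def supCube (d : ℕ) (g : (Fin d → ℝ) → ℝ) : ℝ := ⨆ x : cube d, |g x.1|

/-- The `C^m`-norm: `max_{|α| ≤ m} sup_{x ∈ [0,1]^d} |∂^α f(x)|`. -/
def CmNorm (d m : ℕ) (f : (Fin d → ℝ) → ℝ) : ℝ :=
  ⨆ α : {α : Fin d → ℕ // (∑ i, α i) ≤ m}, supCube d (mderiv d α.1 f)

/-- `λ_m := max_{0 < |α| ≤ m} ∑_i ‖∂^α b_i‖_∞`. -/
def lamNorm (d m : ℕ) (b : Fin d → (Fin d → ℝ) → ℝ) : ℝ :=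
  ⨆ α : {α : Fin d → ℕ // 0 < (∑ i, α i) ∧ (∑ i, α i) ≤ m},
    ∑ i, supCube d (mderiv d α.1 (b i))

/-- One-sided derivative within `[0,1]` for a one-dimensional function. -/
noncomputable def dI (φ : ℝ → ℝ) : ℝ → ℝ := fun z => derivWithin φ (Set.Icc (0:ℝ) 1) z

/-- `φ ∈ C^m([0,1], ℝ)`: derivatives of order `0` through `m` exist
(one-sidedly at the boundary) and are continuous on `[0,1]`. -/
def MemC1d : ℕ → (ℝ → ℝ) → Prop
  | 0, φ => ContinuousOn φ (Set.Icc (0:ℝ) 1)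
  | m + 1, φ => ContinuousOn φ (Set.Icc (0:ℝ) 1) ∧
      (∀ z ∈ Set.Icc (0:ℝ) 1, DifferentiableWithinAt ℝ φ (Set.Icc (0:ℝ) 1) z) ∧
      MemC1d m (dI φ)

/-- The `C^m`-norm of a one-dimensional function: `max_{k ≤ m} sup_{z ∈ [0,1]} |φ^{(k)}(z)|`. -/
noncomputable def C1dNorm (m : ℕ) (φ : ℝ → ℝ) : ℝ :=
  ⨆ k : Fin (m + 1), ⨆ z : Set.Icc (0:ℝ) 1, |dI^[(k : ℕ)] φ z.1|

/-- `PEC d [i₁, …, i_n] g` means: the successive partial derivatives of `g` in the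
coordinates `i₁, …, i_n` (in this order, one-sided at the boundary) exist at every point
of the cube, and the final `n`-th order partial derivative is continuous on the cube. -/
def PEC (d : ℕ) : List (Fin d) → ((Fin d → ℝ) → ℝ) → Prop
  | [], g => ContinuousOn g (cube d)
  | i :: L, g => (∀ x ∈ cube d, DifferentiableWithinAt ℝ
      (fun t => g (Function.update x i t)) (Set.Icc (0:ℝ) 1) (x i)) ∧
      PEC d L (pd d i g)

lemma update_mem_cube {d : ℕ} {y : Fin d → ℝ} (hy : y ∈ cube d) (i : Fin d) {s : ℝ}
    (hs : s ∈ Set.Icc (0:ℝ) 1) : Function.update y i s ∈ cube d := by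
  intro j _
  rcases eq_or_ne j i with rfl | hj
  · simpa using hs
  · simpa [Function.update_of_ne hj] using hy j trivial

lemma isCompact_cube (d : ℕ) : IsCompact (cube d) :=
  isCompact_univ_pi fun _ => isCompact_Icc

lemma exists_bound_on_cube {d : ℕ} {g : (Fin d → ℝ) → ℝ} (hg : ContinuousOn g (cube d)) :
    ∃ C, ∀ x ∈ cube d, ‖g x‖ ≤ C :=
  (isCompact_cube d).exists_bound_of_continuousOn hg

lemma abs_le_supCube {d : ℕ} {g : (Fin d → ℝ) → ℝ} (hg : ContinuousOn g (cube d))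
    {x : Fin d → ℝ} (hx : x ∈ cube d) : |g x| ≤ supCube d g := by
  obtain ⟨C, hC⟩ := exists_bound_on_cube hg
  exact le_ciSup (f := fun x : cube d => |g x.1|)
    ⟨C, by rintro _ ⟨y, rfl⟩; exact hC y.1 y.2⟩ ⟨x, hx⟩

lemma integrable_of_continuousOn_cube {d : ℕ} {ν : Measure (Fin d → ℝ)} [IsFiniteMeasure ν]
    (hν : ∀ᵐ y ∂ν, y ∈ cube d) {g : (Fin d → ℝ) → ℝ} (hg : ContinuousOn g (cube d)) :
    Integrable g ν := by
  have h := hg.integrableOn_compact (μ := ν) (isCompact_cube d)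
  rwa [IntegrableOn, Measure.restrict_eq_self_of_ae_mem hν] at h

lemma continuousOn_comp_update {d : ℕ} {g : (Fin d → ℝ) → ℝ} (hg : ContinuousOn g (cube d))
    (i : Fin d) {s : ℝ} (hs : s ∈ Set.Icc (0:ℝ) 1) :
    ContinuousOn (fun y => g (Function.update y i s)) (cube d) :=
  hg.comp (continuous_id.update i continuous_const).continuousOn
    fun _ hy => update_mem_cube hy i hs

lemma iterate_pd_update (d : ℕ) (i : Fin d) (n : ℕ) (g : (Fin d → ℝ) → ℝ) (x : Fin d → ℝ)
    (t : ℝ) :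
    (pd d i)^[n] g (Function.update x i t) =
      dI^[n] (fun s => g (Function.update x i s)) t := by
  induction n generalizing g with
  | zero => rfl
  | succ n ih =>
    have h : (fun s => pd d i g (Function.update x i s)) =
        dI (fun s => g (Function.update x i s)) := by
      ext s
      simp [pd, dI]
    rw [Function.iterate_succ_apply, Function.iterate_succ_apply, ih, h]

lemma iterate_dI_congr {φ ψ : ℝ → ℝ} (h : Set.EqOn φ ψ (Set.Icc 0 1)) (n : ℕ) :
    Set.EqOn (dI^[n] φ) (dI^[n] ψ) (Set.Icc 0 1) := by
  induction n generalizing φ ψ with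
  | zero => exact h
  | succ n ih => exact ih fun z hz => derivWithin_congr h (h hz)

lemma MemC1d.congr {φ ψ : ℝ → ℝ} {n : ℕ} (hφ : MemC1d n φ)
    (h : Set.EqOn ψ φ (Set.Icc 0 1)) : MemC1d n ψ := by
  induction n generalizing φ ψ with
  | zero => exact ContinuousOn.congr hφ h
  | succ n ih =>
    exact ⟨hφ.1.congr h, fun z hz => (hφ.2.1 z hz).congr h (h hz),
      ih hφ.2.2 fun z hz => derivWithin_congr h (h hz)⟩

lemma MemC1d.continuousOn_iterate_dI {φ : ℝ → ℝ} {n : ℕ} (hφ : MemC1d n φ) :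
    ContinuousOn (dI^[n] φ) (Set.Icc 0 1) := by
  induction n generalizing φ with
  | zero => exact hφ
  | succ n ih => exact ih hφ.2.2

lemma MemC1d.abs_iterate_dI_le {φ : ℝ → ℝ} {n : ℕ} (hφ : MemC1d n φ) {z : ℝ}
    (hz : z ∈ Set.Icc (0:ℝ) 1) : |dI^[n] φ z| ≤ C1dNorm n φ := by
  obtain ⟨C, hC⟩ := isCompact_Icc.exists_bound_of_continuousOn hφ.continuousOn_iterate_dI
  calc |dI^[n] φ z| ≤ ⨆ z : Set.Icc (0:ℝ) 1, |dI^[n] φ z.1| :=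
        le_ciSup (f := fun z : Set.Icc (0:ℝ) 1 => |dI^[n] φ z.1|)
          ⟨C, by rintro _ ⟨y, rfl⟩; exact hC y.1 y.2⟩ ⟨z, hz⟩
    _ ≤ C1dNorm n φ :=
        le_ciSup (f := fun k : Fin (n + 1) => ⨆ z : Set.Icc (0:ℝ) 1, |dI^[(k : ℕ)] φ z.1|)
          (Set.finite_range _).bddAbove (Fin.last n)

lemma MemCm.continuousOn {d m : ℕ} {f : (Fin d → ℝ) → ℝ} (hf : MemCm d m f) :
    ContinuousOn f (cube d) := by
  cases m with
  | zero => exact hf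
  | succ m => exact hf.1

lemma MemCm.continuousOn_iterate_pd {d m : ℕ} {f : (Fin d → ℝ) → ℝ} (hf : MemCm d m f)
    (i : Fin d) {k : ℕ} (hk : k ≤ m) : ContinuousOn ((pd d i)^[k] f) (cube d) := by
  induction k generalizing m f with
  | zero => exact hf.continuousOn
  | succ k ih =>
    obtain ⟨m, rfl⟩ : ∃ m', m = m' + 1 := ⟨m - 1, by omega⟩
    exact ih (hf.2 i).2 (by omega)

/-- Averaging over all coordinates but the `i`-th, with the `i`-th one frozen at `s`. -/
def freezeAverage {d : ℕ} (ν : Measure (Fin d → ℝ)) (i : Fin d) (g : (Fin d → ℝ) → ℝ)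
    (s : ℝ) : ℝ :=
  ∫ y, g (Function.update y i s) ∂ν

lemma abs_freezeAverage_le {d : ℕ} {ν : Measure (Fin d → ℝ)} [IsProbabilityMeasure ν]
    (hν : ∀ᵐ y ∂ν, y ∈ cube d) (i : Fin d) {g : (Fin d → ℝ) → ℝ}
    (hg : ContinuousOn g (cube d)) {s : ℝ} (hs : s ∈ Set.Icc (0:ℝ) 1) :
    |freezeAverage ν i g s| ≤ supCube d g := by
  have h := norm_integral_le_of_norm_le_const (μ := ν)
    (f := fun y => g (Function.update y i s)) (C := supCube d g) (by
      filter_upwards [hν] with y hy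
      exact abs_le_supCube hg (update_mem_cube hy i hs))
  simpa [freezeAverage] using h

lemma continuousOn_freezeAverage {d : ℕ} {ν : Measure (Fin d → ℝ)} [IsProbabilityMeasure ν]
    (hν : ∀ᵐ y ∂ν, y ∈ cube d) (i : Fin d) {g : (Fin d → ℝ) → ℝ}
    (hg : ContinuousOn g (cube d)) :
    ContinuousOn (freezeAverage ν i g) (Set.Icc 0 1) := by
  obtain ⟨C, hC⟩ := exists_bound_on_cube hg
  refine continuousOn_of_dominated (bound := fun _ => C) (fun s hs => ?_) (fun s hs => ?_)
    (integrable_const C) ?_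
  · exact (integrable_of_continuousOn_cube hν (continuousOn_comp_update hg i hs)).1
  · filter_upwards [hν] with y hy
    exact hC _ (update_mem_cube hy i hs)
  · filter_upwards [hν] with y hy
    have hu : Continuous fun s : ℝ => Function.update y i s :=
      continuous_const.update i continuous_id
    exact hg.comp hu.continuousOn fun s hs => update_mem_cube hy i hs

lemma hasDerivWithinAt_freezeAverage {d : ℕ} {ν : Measure (Fin d → ℝ)}
    [IsProbabilityMeasure ν] (hν : ∀ᵐ y ∂ν, y ∈ cube d) (i : Fin d) {g : (Fin d → ℝ) → ℝ}
    (hg : ContinuousOn g (cube d)) (hg' : ContinuousOn (pd d i g) (cube d))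
    (hd : ∀ x ∈ cube d, DifferentiableWithinAt ℝ (fun t => g (Function.update x i t))
        (Set.Icc (0:ℝ) 1) (x i)) {s : ℝ} (hs : s ∈ Set.Icc (0:ℝ) 1) :
    HasDerivWithinAt (freezeAverage ν i g) (freezeAverage ν i (pd d i g) s)
      (Set.Icc 0 1) s := by
  obtain ⟨C, hC⟩ := exists_bound_on_cube hg'
  have hderiv : ∀ y ∈ cube d, ∀ t ∈ Set.Icc (0:ℝ) 1,
      HasDerivWithinAt (fun t => g (Function.update y i t))
        (pd d i g (Function.update y i t)) (Set.Icc 0 1) t := by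
    intro y hy t ht
    have h := (hd _ (update_mem_cube hy i ht)).hasDerivWithinAt
    simpa [pd] using h
  have hint : ∀ t ∈ Set.Icc (0:ℝ) 1, Integrable (fun y => g (Function.update y i t)) ν :=
    fun t ht => integrable_of_continuousOn_cube hν (continuousOn_comp_update hg i ht)
  rw [hasDerivWithinAt_iff_tendsto_slope]
  have hmem : ∀ᶠ t in nhdsWithin s (Set.Icc (0:ℝ) 1 \ {s}), t ∈ Set.Icc (0:ℝ) 1 \ {s} :=
    self_mem_nhdsWithin
  have key : Tendsto
      (fun t => ∫ y, slope (fun t => g (Function.update y i t)) s t ∂ν)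
      (nhdsWithin s (Set.Icc (0:ℝ) 1 \ {s}))
      (nhds (freezeAverage ν i (pd d i g) s)) := by
    refine tendsto_integral_filter_of_dominated_convergence (fun _ => C) ?_ ?_
      (integrable_const C) ?_
    · filter_upwards [hmem] with t ht
      simp only [slope_def_field]
      exact (((hint t ht.1).sub (hint s hs)).div_const _).1
    · filter_upwards [hmem] with t ht
      filter_upwards [hν] with y hy
      have h := (convex_Icc (0:ℝ) 1).norm_image_sub_le_of_norm_hasDerivWithin_le
        (hderiv y hy) (fun t ht => hC _ (update_mem_cube hy i ht)) hs ht.1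
      rw [slope_def_field, norm_div]
      exact (div_le_iff₀ (norm_pos_iff.2 (sub_ne_zero.2 ht.2))).2 h
    · filter_upwards [hν] with y hy
      exact hasDerivWithinAt_iff_tendsto_slope.1 (hderiv y hy s hs)
  refine key.congr' ?_
  filter_upwards [hmem] with t ht
  simp only [slope_def_field, freezeAverage]
  rw [integral_div, integral_sub (hint t ht.1) (hint s hs)]

lemma dI_freezeAverage {d m : ℕ} {ν : Measure (Fin d → ℝ)} [IsProbabilityMeasure ν]
    (hν : ∀ᵐ y ∂ν, y ∈ cube d) (i : Fin d) {f : (Fin d → ℝ) → ℝ} (hf : MemCm d (m + 1) f) :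
    Set.EqOn (dI (freezeAverage ν i f)) (freezeAverage ν i (pd d i f)) (Set.Icc 0 1) :=
  fun s hs => (hasDerivWithinAt_freezeAverage hν i hf.1 (hf.2 i).2.continuousOn
    (hf.2 i).1 hs).derivWithin (uniqueDiffOn_Icc zero_lt_one s hs)

lemma memC1d_freezeAverage {d m : ℕ} {ν : Measure (Fin d → ℝ)} [IsProbabilityMeasure ν]
    (hν : ∀ᵐ y ∂ν, y ∈ cube d) (i : Fin d) {f : (Fin d → ℝ) → ℝ} (hf : MemCm d m f) :
    MemC1d m (freezeAverage ν i f) := by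
  induction m generalizing f with
  | zero => exact continuousOn_freezeAverage hν i hf
  | succ m ih =>
    exact ⟨continuousOn_freezeAverage hν i hf.1,
      fun s hs => (hasDerivWithinAt_freezeAverage hν i hf.1 (hf.2 i).2.continuousOn
        (hf.2 i).1 hs).differentiableWithinAt,
      (ih (hf.2 i).2).congr (dI_freezeAverage hν i hf)⟩

lemma iterate_dI_freezeAverage {d m : ℕ} {ν : Measure (Fin d → ℝ)} [IsProbabilityMeasure ν]
    (hν : ∀ᵐ y ∂ν, y ∈ cube d) (i : Fin d) {f : (Fin d → ℝ) → ℝ} (hf : MemCm d m f)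
    {k : ℕ} (hk : k ≤ m) :
    Set.EqOn (dI^[k] (freezeAverage ν i f)) (freezeAverage ν i ((pd d i)^[k] f))
      (Set.Icc 0 1) := by
  induction k generalizing m f with
  | zero => exact fun _ _ => rfl
  | succ k ih =>
    obtain ⟨m, rfl⟩ : ∃ m', m = m' + 1 := ⟨m - 1, by omega⟩
    exact (iterate_dI_congr (dI_freezeAverage hν i hf) k).trans
      (ih (hf.2 i).2 (by omega))

lemma C1dNorm_freezeAverage_le {d m : ℕ} {ν : Measure (Fin d → ℝ)} [IsProbabilityMeasure ν]
    (hν : ∀ᵐ y ∂ν, y ∈ cube d) (i : Fin d) {f : (Fin d → ℝ) → ℝ} (hf : MemCm d m f) :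
    C1dNorm m (freezeAverage ν i f) ≤
      ⨆ k : Fin (m + 1), supCube d ((pd d i)^[(k : ℕ)] f) := by
  have : Nonempty (Set.Icc (0:ℝ) 1) := ⟨⟨0, by simp⟩⟩
  refine ciSup_mono (Set.finite_range _).bddAbove fun k => ciSup_le fun z => ?_
  have hk : (k : ℕ) ≤ m := Nat.lt_succ_iff.1 k.2
  rw [iterate_dI_freezeAverage hν i hf hk z.2]
  exact abs_freezeAverage_le hν i (hf.continuousOn_iterate_pd i hk) z.2

/-- Resampling the `i`-th coordinate of a product measure replaces its `i`-th factor. -/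
lemma map_update_pi_prod {d : ℕ} (μ : Fin d → Measure ℝ) [∀ k, IsProbabilityMeasure (μ k)]
    (i : Fin d) (ρ : Fin d → Measure ℝ) [∀ k, IsProbabilityMeasure (ρ k)]
    (hρ : ∀ k, k ≠ i → ρ k = μ k) :
    Measure.map (fun q : (Fin d → ℝ) × ℝ => Function.update q.1 i q.2)
      ((Measure.pi μ).prod (ρ i)) = Measure.pi ρ := by
  have hm : Measurable fun q : (Fin d → ℝ) × ℝ => Function.update q.1 i q.2 :=
    (continuous_fst.update i continuous_snd).measurable
  refine (Measure.pi_eq fun s hs => ?_).symm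
  rw [Measure.map_apply hm (MeasurableSet.univ_pi hs)]
  have hpre : (fun q : (Fin d → ℝ) × ℝ => Function.update q.1 i q.2) ⁻¹' Set.univ.pi s =
      (Set.univ.pi (Function.update s i Set.univ)) ×ˢ s i := by
    ext ⟨y, t⟩
    simp only [Set.mem_preimage, Set.mem_univ_pi, Set.mem_prod]
    constructor
    · intro h
      refine ⟨fun j => ?_, by simpa using h i⟩
      rcases eq_or_ne j i with rfl | hj
      · simp
      · simpa [hj] using h j
    · rintro ⟨h, ht⟩ j
      rcases eq_or_ne j i with rfl | hj
      · simpa using ht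
      · simpa [hj] using h j
  rw [hpre, Measure.prod_prod, Measure.pi_pi, ← Finset.mul_prod_erase _ _ (Finset.mem_univ i),
    ← Finset.mul_prod_erase _ (fun j => ρ j (s j)) (Finset.mem_univ i), Function.update_self,
    measure_univ, one_mul, mul_comm]
  congr 1
  refine Finset.prod_congr rfl fun j hj => ?_
  rw [Function.update_of_ne (Finset.ne_of_mem_erase hj), hρ j (Finset.ne_of_mem_erase hj)]

lemma ae_mem_cube_pi {d : ℕ} (μ : Fin d → Measure ℝ) [∀ k, IsProbabilityMeasure (μ k)]
    (h : ∀ k, μ k (Set.Icc (0:ℝ) 1)ᶜ = 0) : ∀ᵐ y ∂Measure.pi μ, y ∈ cube d := by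
  have hk : ∀ k, ∀ᵐ y ∂Measure.pi μ, y k ∈ Set.Icc (0:ℝ) 1 := fun k =>
    (Measure.quasiMeasurePreserving_eval μ k).ae (mem_ae_iff.2 (h k))
  filter_upwards [ae_all_iff.2 hk] with y hy
  exact fun k _ => hy k

lemma integral_freezeAverage {d : ℕ} (μ : Fin d → Measure ℝ)
    [∀ k, IsProbabilityMeasure (μ k)] (i : Fin d) (ρ : Fin d → Measure ℝ)
    [∀ k, IsProbabilityMeasure (ρ k)] (hρ : ∀ k, k ≠ i → ρ k = μ k)
    (hsupp : ∀ k, ρ k (Set.Icc (0:ℝ) 1)ᶜ = 0) {f : (Fin d → ℝ) → ℝ}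
    (hf : ContinuousOn f (cube d)) :
    ∫ y, f y ∂Measure.pi ρ = ∫ s, freezeAverage (Measure.pi μ) i f s ∂ρ i := by
  have hm : Measurable fun q : (Fin d → ℝ) × ℝ => Function.update q.1 i q.2 :=
    (continuous_fst.update i continuous_snd).measurable
  have hint := integrable_of_continuousOn_cube (ae_mem_cube_pi ρ hsupp) hf
  rw [← map_update_pi_prod μ i ρ hρ] at hint ⊢
  rw [integral_map hm.aemeasurable hint.1]
  exact integral_prod_symm _ (hint.comp_measurable hm)

/-- Pointwise bound on pure partial derivatives of the product-kernel operator: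
`|(∂^n/∂x_i^n)(T²f)(x)| ≤ c · max_{k ≤ n} ‖∂^k f/∂x_i^k‖_∞`. -/
theorem pure_derivative_bound_product_kernel
    (d : ℕ) (hd : 0 < d) (n : ℕ) (hn : n ≤ 3) (c : ℝ) (hc : 1 ≤ c)
    (p : Fin d → ℝ → Measure ℝ)
    [∀ k z, IsProbabilityMeasure (p k z)]
    (hmeas : ∀ k : Fin d, Measurable (p k))
    (hsupp : ∀ k : Fin d, ∀ z, p k z (Set.Icc (0:ℝ) 1)ᶜ = 0)
    (hp : ∀ k : Fin d, ∀ m' ≤ n, ∀ φ : ℝ → ℝ, MemC1d m' φ →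
      MemC1d m' (fun z => ∫ y, φ y ∂ p k z) ∧
      C1dNorm m' (fun z => ∫ y, φ y ∂ p k z) ≤ c * C1dNorm m' φ)
    (f : (Fin d → ℝ) → ℝ) (hf : MemCm d n f) (i : Fin d)
    (x : Fin d → ℝ) (hx : x ∈ cube d) :
    |(pd d i)^[n] (fun x' : Fin d → ℝ => ∫ y, f y ∂ Measure.pi (fun k => p k (x' k))) x| ≤
      c * ⨆ k : Fin (n + 1), supCube d ((pd d i)^[(k : ℕ)] f) := by
  have hν : ∀ᵐ y ∂Measure.pi (fun k => p k (x k)), y ∈ cube d :=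
    ae_mem_cube_pi _ fun k => hsupp k (x k)
  have hfub : ∀ t, ∫ y, f y ∂Measure.pi (fun k => p k (Function.update x i t k)) =
      ∫ s, freezeAverage (Measure.pi fun k => p k (x k)) i f s ∂p i t := by
    intro t
    have h := integral_freezeAverage (fun k => p k (x k)) i
      (fun k => p k (Function.update x i t k))
      (fun k hk => by rw [Function.update_of_ne hk]) (fun k => hsupp k _) hf.continuousOn
    rwa [Function.update_self] at h
  obtain ⟨hmem, hle⟩ := hp i n le_rfl _ (memC1d_freezeAverage hν i hf)
  have hbound := hmem.abs_iterate_dI_le (hx i trivial)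
  rw [← Function.update_eq_self i x, iterate_pd_update]
  simp only [hfub]
  exact (hbound.trans hle).trans
    (mul_le_mul_of_nonneg_left (C1dNorm_freezeAverage_le hν i hf) (zero_le_one.trans hc))

end
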